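/- Strict monotonicity of the regularized Herschel–Bulkley map: let 1 < p < ∞, μ > 0, τ_s > 0, γ > 0, and define G(A) := μ|A|^{p−2}A + γ τ_s A / max(τ_s, γ|A|) for A ∈ ℝ^{d×d} (with μ|A|^{p−2}A understood as 0 when A = 0). Then for all A, B ∈ ℝ^{d×d} with A ≠ B, ⟨G(A) − G(B), A − B⟩ > 0. -/

import Mathlib

open MeasureTheory Real Set

/-- The Frobenius inner product on real `d × d` matrices: `⟨A,B⟩ = tr (A Bᵀ)`. -/
noncomputable def frobInner {d : ℕ} (A B : Matrix (Fin d) (Fin d) ℝ) : ℝ :=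
  Matrix.trace (A * Matrix.transpose B)

/-- The Frobenius norm `|A| = √⟨A,A⟩`. -/
noncomputable def frobNorm {d : ℕ} (A : Matrix (Fin d) (Fin d) ℝ) : ℝ :=
  Real.sqrt (frobInner A A)

/-- The Huber-regularized modulus `|A|_γ = max (τ_s, γ |A|)`. -/
noncomputable def huberMod {d : ℕ} (τs γ : ℝ) (A : Matrix (Fin d) (Fin d) ℝ) : ℝ :=
  max τs (γ * frobNorm A)

/-- The Huber map `H_γ(A) = γ τ_s A / |A|_γ`. -/
noncomputable def huberMap {d : ℕ} (τs γ : ℝ) (A : Matrix (Fin d) (Fin d) ℝ) :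
    Matrix (Fin d) (Fin d) ℝ :=
  (γ * τs / huberMod τs γ A) • A

/-- The regularized Herschel–Bulkley map
`G(A) = μ |A|^(p-2) A + γ τ_s A / max (τ_s, γ|A|)`
(the first term is `0` when `A = 0`, since it is a scalar multiple of `A`). -/
noncomputable def regHB {d : ℕ} (p μ τs γ : ℝ) (A : Matrix (Fin d) (Fin d) ℝ) :
    Matrix (Fin d) (Fin d) ℝ :=
  (μ * frobNorm A ^ (p - 2)) • A + huberMap τs γ A

theorem frobInner_eq_sum {d : ℕ} (A B : Matrix (Fin d) (Fin d) ℝ) :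
    frobInner A B = ∑ x : Fin d × Fin d, A x.1 x.2 * B x.1 x.2 := by
  simp [frobInner, Matrix.trace, Matrix.mul_apply, Fintype.sum_prod_type]

theorem frobInner_le_frobNorm_mul_frobNorm {d : ℕ} (A B : Matrix (Fin d) (Fin d) ℝ) :
    frobInner A B ≤ frobNorm A * frobNorm B := by
  simp only [frobNorm, frobInner_eq_sum, ← pow_two]
  exact Real.sum_mul_le_sqrt_mul_sqrt _ _ _

theorem frobInner_self_nonneg {d : ℕ} (A : Matrix (Fin d) (Fin d) ℝ) : 0 ≤ frobInner A A := by
  rw [frobInner_eq_sum]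
  exact Finset.sum_nonneg fun x _ => mul_self_nonneg _

theorem frobInner_self_pos {d : ℕ} {A : Matrix (Fin d) (Fin d) ℝ} (hA : A ≠ 0) :
    0 < frobInner A A := by
  refine (frobInner_self_nonneg A).lt_of_ne' fun h => hA ?_
  rw [frobInner_eq_sum, Finset.sum_eq_zero_iff_of_nonneg fun x _ => mul_self_nonneg _] at h
  ext i j
  simpa using h (i, j) (Finset.mem_univ _)

theorem frobNorm_sq {d : ℕ} (A : Matrix (Fin d) (Fin d) ℝ) : frobNorm A ^ 2 = frobInner A A :=
  Real.sq_sqrt (frobInner_self_nonneg A)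

theorem frobInner_smul_sub_smul_sub {d : ℕ} (s t : ℝ) (A B : Matrix (Fin d) (Fin d) ℝ) :
    frobInner (s • A - t • B) (A - B) =
      s * frobNorm A ^ 2 + t * frobNorm B ^ 2 - (s + t) * frobInner A B := by
  simp only [frobNorm_sq, frobInner_eq_sum, Finset.mul_sum, ← Finset.sum_add_distrib,
    ← Finset.sum_sub_distrib, Matrix.sub_apply, Matrix.smul_apply, smul_eq_mul]
  exact Finset.sum_congr rfl fun x _ => by ring

/-- A radial map `A ↦ g |A| • A` with `g` positive and `r ↦ g r * r` strictly increasing is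
strictly monotone. -/
theorem frobInner_radial_sub_pos {d : ℕ} {g : ℝ → ℝ} (hg : ∀ r, 0 ≤ r → 0 < g r)
    (hmono : StrictMonoOn (fun r => g r * r) (Ici 0))
    {A B : Matrix (Fin d) (Fin d) ℝ} (hAB : A ≠ B) :
    0 < frobInner (g (frobNorm A) • A - g (frobNorm B) • B) (A - B) := by
  have hsub : 0 < frobNorm A ^ 2 + frobNorm B ^ 2 - 2 * frobInner A B := by
    have h := frobInner_smul_sub_smul_sub 1 1 A B
    have h' := frobInner_self_pos (sub_ne_zero.mpr hAB)
    simp only [one_smul] at h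
    linarith
  have hcs := frobInner_le_frobNorm_mul_frobNorm A B
  have ha : 0 ≤ frobNorm A := Real.sqrt_nonneg _
  have hb : 0 ≤ frobNorm B := Real.sqrt_nonneg _
  rw [frobInner_smul_sub_smul_sub]
  generalize frobNorm A = a at *
  generalize frobNorm B = b at *
  generalize frobInner A B = c at *
  have hsum : 0 < g a + g b := add_pos (hg a ha) (hg b hb)
  have hsplit : g a * a ^ 2 + g b * b ^ 2 - (g a + g b) * c =
      (g a * a - g b * b) * (a - b) + (g a + g b) * (a * b - c) := by ring
  rw [hsplit]
  rcases lt_trichotomy a b with h | rfl | h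
  · exact add_pos_of_pos_of_nonneg
      (mul_pos_of_neg_of_neg (sub_neg.mpr (hmono ha hb h)) (sub_neg.mpr h))
      (mul_nonneg hsum.le (sub_nonneg.mpr hcs))
  · have : 0 < (g a + g a) * (a * a - c) := mul_pos hsum (by nlinarith)
    simpa using this
  · exact add_pos_of_pos_of_nonneg
      (mul_pos (sub_pos.mpr (hmono hb ha h)) (sub_pos.mpr h))
      (mul_nonneg hsum.le (sub_nonneg.mpr hcs))

theorem strictMonoOn_rpow_sub_two_mul_self {p : ℝ} (hp : 1 < p) :
    StrictMonoOn (fun r : ℝ => r ^ (p - 2) * r) (Ici 0) := by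
  have hpos : 0 < p - 1 := by linarith
  refine (Real.strictMonoOn_rpow_Ici_of_exponent_pos hpos).congr fun r hr => ?_
  rcases (mem_Ici.mp hr).eq_or_lt with rfl | h
  · simp [Real.zero_rpow hpos.ne']
  · change r ^ (p - 1) = r ^ (p - 2) * r
    rw [← Real.rpow_add_one h.ne']
    congr 1
    ring

theorem monotoneOn_div_max_mul_self {τ γ : ℝ} (hτ : 0 < τ) (hγ : 0 < γ) :
    MonotoneOn (fun r : ℝ => γ * τ / max τ (γ * r) * r) (Ici 0) := by
  intro a ha b _ hab
  have hA : 0 < max τ (γ * a) := lt_max_of_lt_left hτ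
  have hB : 0 < max τ (γ * b) := lt_max_of_lt_left hτ
  have hcross : a * max τ (γ * b) ≤ b * max τ (γ * a) := by
    have hb : 0 ≤ b := le_trans ha hab
    rw [mul_max_of_nonneg _ _ ha, mul_max_of_nonneg _ _ hb]
    exact max_le_max (mul_le_mul_of_nonneg_right hab hτ.le) (le_of_eq (by ring))
  change γ * τ / max τ (γ * a) * a ≤ γ * τ / max τ (γ * b) * b
  rw [div_mul_eq_mul_div, div_mul_eq_mul_div, div_le_div_iff₀ hA hB, mul_assoc, mul_assoc (γ * τ)]
  exact mul_le_mul_of_nonneg_left hcross (mul_pos hγ hτ).le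

theorem regHB_strictly_monotone {d : ℕ} (p μ τs γ : ℝ) (hp : 1 < p) (hμ : 0 < μ)
    (hτ : 0 < τs) (hγ : 0 < γ)
    (A B : Matrix (Fin d) (Fin d) ℝ) (hAB : A ≠ B) :
    0 < frobInner (regHB p μ τs γ A - regHB p μ τs γ B) (A - B) := by
  have hpos : ∀ r : ℝ, 0 ≤ r → 0 < μ * r ^ (p - 2) + γ * τs / max τs (γ * r) := fun r hr =>
    add_pos_of_nonneg_of_pos (mul_nonneg hμ.le (Real.rpow_nonneg hr _))
      (div_pos (mul_pos hγ hτ) (lt_max_of_lt_left hτ))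
  have hmono : StrictMonoOn
      (fun r : ℝ => (μ * r ^ (p - 2) + γ * τs / max τs (γ * r)) * r) (Ici 0) := by
    intro a ha b hb hab
    have h₁ := mul_lt_mul_of_pos_left (strictMonoOn_rpow_sub_two_mul_self hp ha hb hab) hμ
    have h₂ := monotoneOn_div_max_mul_self hτ hγ ha hb hab.le
    simp only [add_mul, mul_assoc μ] at h₁ h₂ ⊢
    exact add_lt_add_of_lt_of_le h₁ h₂
  simpa only [regHB, huberMap, huberMod, add_smul] using
    frobInner_radial_sub_pos hpos hmono hAB
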